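/- Let (A(l))_{l≥0} be a sequence of n×n row-stochastic matrices, let L be a positive integer and ρ ∈ (0,1] be such that every product of L consecutive matrices from the sequence satisfies λ(A(s+L−1)·…·A(s)) ≤ 1 − ρ for all s ≥ 0. For k ≤ t let P(k,t) := A(t)·A(t−1)·…·A(k) and let p(k,t)ᵀ := (1/n)·𝟏ᵀ·P(k,t) be the row vector of column means of P(k,t). Then ‖P(k,t) − 𝟏·p(k,t)ᵀ‖_F ≤ n·(1 − ρ)^{⌊(t−k+1)/L⌋}, where ‖·‖_F is the Frobenius norm. -/

import Mathlib

/-- `λ(X) := 1 - min_{i₁,i₂} Σ_j min(X_{i₁,j}, X_{i₂,j})`. -/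
noncomputable def lam {n : ℕ} (X : Matrix (Fin n) (Fin n) ℝ) : ℝ :=
  1 - ⨅ i₁ : Fin n, ⨅ i₂ : Fin n, ∑ j : Fin n, min (X i₁ j) (X i₂ j)

/-- A matrix is row-stochastic if all entries are nonnegative and each row sums to 1. -/
def IsRowStochastic {n : ℕ} (X : Matrix (Fin n) (Fin n) ℝ) : Prop :=
  (∀ i j, 0 ≤ X i j) ∧ ∀ i, ∑ j, X i j = 1

/-- The descending product `A(t)·A(t−1)·…·A(k)`. -/
def descProd {n : ℕ} (A : ℕ → Matrix (Fin n) (Fin n) ℝ) (k t : ℕ) :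
    Matrix (Fin n) (Fin n) ℝ :=
  (List.ofFn (fun i : Fin (t + 1 - k) => A (t - (i : ℕ)))).prod

/-- Frobenius norm: square root of the sum of squares of all entries. -/
noncomputable def frobNorm {n : ℕ} (X : Matrix (Fin n) (Fin n) ℝ) : ℝ :=
  Real.sqrt (∑ i, ∑ j, (X i j) ^ 2)

theorem one_sub_sum_min_le_lam {n : ℕ} (X : Matrix (Fin n) (Fin n) ℝ) (a b : Fin n) :
    1 - ∑ j, min (X a j) (X b j) ≤ lam X := by
  have h₁ := ciInf_le (Set.finite_range
    (fun i₁ : Fin n => ⨅ i₂ : Fin n, ∑ j : Fin n, min (X i₁ j) (X i₂ j))).bddBelow a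
  have h₂ := ciInf_le (Set.finite_range
    (fun i₂ : Fin n => ∑ j : Fin n, min (X a j) (X i₂ j))).bddBelow b
  unfold lam
  linarith

theorem IsRowStochastic.sum_mul_sub_sum_mul_le {n : ℕ} {X : Matrix (Fin n) (Fin n) ℝ}
    (hX : IsRowStochastic X) {v : Fin n → ℝ} {c : ℝ} (hv : ∀ i i', v i - v i' ≤ c)
    (a b : Fin n) :
    ∑ j, X a j * v j - ∑ j, X b j * v j ≤ lam X * c := by
  have : Nonempty (Fin n) := ⟨a⟩
  obtain ⟨p, hp⟩ := Finite.exists_max v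
  obtain ⟨q, hq⟩ := Finite.exists_min v
  set S := 1 - ∑ j, min (X a j) (X b j) with hS
  have ha : ∑ j, (X a j - min (X a j) (X b j)) = S := by
    rw [Finset.sum_sub_distrib, hX.2 a]
  have hb : ∑ j, (X b j - min (X a j) (X b j)) = S := by
    rw [Finset.sum_sub_distrib, hX.2 b]
  have hS0 : 0 ≤ S := ha ▸ Finset.sum_nonneg fun j _ => sub_nonneg.2 (min_le_left _ _)
  have hc : 0 ≤ c := by simpa using hv a a
  have hup : ∑ j, (X a j - min (X a j) (X b j)) * v j ≤ S * v p := by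
    rw [← ha, Finset.sum_mul]
    exact Finset.sum_le_sum fun j _ =>
      mul_le_mul_of_nonneg_left (hp j) (sub_nonneg.2 (min_le_left _ _))
  have hlow : S * v q ≤ ∑ j, (X b j - min (X a j) (X b j)) * v j := by
    rw [← hb, Finset.sum_mul]
    exact Finset.sum_le_sum fun j _ =>
      mul_le_mul_of_nonneg_left (hq j) (sub_nonneg.2 (min_le_right _ _))
  simp only [sub_mul, Finset.sum_sub_distrib] at hup hlow
  calc ∑ j, X a j * v j - ∑ j, X b j * v j ≤ S * (v p - v q) := by linarith
    _ ≤ S * c := mul_le_mul_of_nonneg_left (hv p q) hS0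
    _ ≤ lam X * c := mul_le_mul_of_nonneg_right (one_sub_sum_min_le_lam X a b) hc

theorem IsRowStochastic.one {n : ℕ} : IsRowStochastic (1 : Matrix (Fin n) (Fin n) ℝ) := by
  refine ⟨fun i j => ?_, fun i => by simp [Matrix.one_apply]⟩
  rw [Matrix.one_apply]
  split_ifs <;> norm_num

theorem IsRowStochastic.mul {n : ℕ} {X Y : Matrix (Fin n) (Fin n) ℝ}
    (hX : IsRowStochastic X) (hY : IsRowStochastic Y) : IsRowStochastic (X * Y) := by
  refine ⟨fun i j => ?_, fun i => ?_⟩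
  · rw [Matrix.mul_apply]
    exact Finset.sum_nonneg fun l _ => mul_nonneg (hX.1 i l) (hY.1 l j)
  · simp only [Matrix.mul_apply]
    rw [Finset.sum_comm]
    simp only [← Finset.mul_sum, hY.2, mul_one, hX.2]

theorem IsRowStochastic.le_one {n : ℕ} {X : Matrix (Fin n) (Fin n) ℝ}
    (hX : IsRowStochastic X) (i j : Fin n) : X i j ≤ 1 :=
  hX.2 i ▸ Finset.single_le_sum (f := X i) (fun l _ => hX.1 i l) (Finset.mem_univ j)

/-- The descending product `A(k+m-1)·…·A(k)` of `m` consecutive factors. -/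
def windowProd {n : ℕ} (A : ℕ → Matrix (Fin n) (Fin n) ℝ) (k : ℕ) :
    ℕ → Matrix (Fin n) (Fin n) ℝ
  | 0 => 1
  | m + 1 => A (k + m) * windowProd A k m

theorem windowProd_add {n : ℕ} (A : ℕ → Matrix (Fin n) (Fin n) ℝ) (k m l : ℕ) :
    windowProd A k (m + l) = windowProd A (k + m) l * windowProd A k m := by
  induction l with
  | zero => simp [windowProd]
  | succ l ih => rw [← add_assoc, windowProd, ih, windowProd, mul_assoc, add_assoc]

theorem prod_ofFn_eq_windowProd {n : ℕ} (A : ℕ → Matrix (Fin n) (Fin n) ℝ) (k m : ℕ) :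
    (List.ofFn (fun i : Fin m => A (k + m - 1 - (i : ℕ)))).prod = windowProd A k m := by
  induction m with
  | zero => simp [windowProd]
  | succ m ih =>
    rw [List.ofFn_succ, List.prod_cons, windowProd, ← ih]
    congr 4
    funext i
    congr 1
    simp only [Fin.val_succ]
    omega

theorem descProd_eq_windowProd {n : ℕ} (A : ℕ → Matrix (Fin n) (Fin n) ℝ) (k m : ℕ) :
    descProd A k (k + m) = windowProd A k (m + 1) := by
  have h : k + m + 1 - k = m + 1 := by omega
  rw [← prod_ofFn_eq_windowProd, descProd, h]
  rfl

theorem isRowStochastic_windowProd {n : ℕ} {A : ℕ → Matrix (Fin n) (Fin n) ℝ}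
    (hA : ∀ l, IsRowStochastic (A l)) (k m : ℕ) : IsRowStochastic (windowProd A k m) := by
  induction m with
  | zero => exact .one
  | succ m ih => exact (hA _).mul ih

theorem windowProd_sub_le {n : ℕ} {A : ℕ → Matrix (Fin n) (Fin n) ℝ}
    (hA : ∀ l, IsRowStochastic (A l)) {L : ℕ} (hL : 0 < L) {r : ℝ} (hr : 0 ≤ r)
    (hlam : ∀ s, lam (windowProd A s L) ≤ r) (k m : ℕ) (j a b : Fin n) :
    windowProd A k m a j - windowProd A k m b j ≤ r ^ (m / L) := by
  induction m using Nat.strong_induction_on generalizing a b with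
  | _ m ih =>
    rcases lt_or_ge m L with h | h
    · have hP := isRowStochastic_windowProd hA k m
      rw [Nat.div_eq_of_lt h, pow_zero]
      linarith [hP.le_one a j, hP.1 b j]
    · obtain ⟨d, rfl⟩ := Nat.exists_eq_add_of_le' h
      rw [windowProd_add, Matrix.mul_apply, Matrix.mul_apply, Nat.add_div_right _ hL, pow_succ']
      exact ((isRowStochastic_windowProd hA (k + d) L).sum_mul_sub_sum_mul_le
        (v := fun i => windowProd A k d i j) (fun i i' => ih d (by omega) i i') a b).trans
        (mul_le_mul_of_nonneg_right (hlam _) (pow_nonneg hr _))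

theorem abs_sub_mean_le {n : ℕ} {v : Fin n → ℝ} {c : ℝ} (hv : ∀ i i', v i - v i' ≤ c)
    (i : Fin n) : |v i - (1 / (n : ℝ)) * ∑ i', v i'| ≤ c := by
  have hn : (0 : ℝ) < n := Nat.cast_pos.2 i.pos
  have h : v i - (1 / (n : ℝ)) * ∑ i', v i' = (∑ i', (v i - v i')) / n := by
    rw [Finset.sum_sub_distrib]
    simp
    field_simp
  rw [h, abs_div, abs_of_pos hn, div_le_iff₀ hn]
  calc |∑ i', (v i - v i')| ≤ ∑ i', |v i - v i'| := Finset.abs_sum_le_sum_abs _ _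
    _ ≤ ∑ _i' : Fin n, c := Finset.sum_le_sum fun i' _ =>
        abs_le.2 ⟨by linarith [hv i' i], hv i i'⟩
    _ = c * n := by simp [mul_comm]

theorem frobNorm_le_of_abs_le {n : ℕ} {X : Matrix (Fin n) (Fin n) ℝ} {c : ℝ} (hc : 0 ≤ c)
    (hX : ∀ i j, |X i j| ≤ c) : frobNorm X ≤ n * c := by
  refine Real.sqrt_le_iff.2 ⟨by positivity, ?_⟩
  calc ∑ i, ∑ j, X i j ^ 2 ≤ ∑ _i : Fin n, ∑ _j : Fin n, c ^ 2 :=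
        Finset.sum_le_sum fun i _ => Finset.sum_le_sum fun j _ =>
          sq_le_sq' (abs_le.1 (hX i j)).1 (abs_le.1 (hX i j)).2
    _ = (n * c) ^ 2 := by
      simp
      ring

theorem stmt10 {n : ℕ} (A : ℕ → Matrix (Fin n) (Fin n) ℝ)
    (hA : ∀ l, IsRowStochastic (A l)) (L : ℕ) (hL : 0 < L)
    (ρ : ℝ) (hρ0 : 0 < ρ) (hρ1 : ρ ≤ 1)
    (hlam : ∀ s, lam (descProd A s (s + L - 1)) ≤ 1 - ρ) :
    ∀ k t, k ≤ t →
      frobNorm (Matrix.of fun i j =>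
          descProd A k t i j - (1 / (n : ℝ)) * ∑ i', descProd A k t i' j)
        ≤ n * (1 - ρ) ^ ((t - k + 1) / L) := by
  intro k t hkt
  obtain ⟨m, rfl⟩ := Nat.exists_eq_add_of_le hkt
  have hr : 0 ≤ 1 - ρ := sub_nonneg.2 hρ1
  have hwin : ∀ s, lam (windowProd A s L) ≤ 1 - ρ := by
    intro s
    obtain ⟨l, rfl⟩ := Nat.exists_eq_succ_of_ne_zero hL.ne'
    have h := hlam s
    rwa [show s + l.succ - 1 = s + l by omega, descProd_eq_windowProd] at h
  rw [descProd_eq_windowProd, Nat.add_sub_cancel_left]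
  refine frobNorm_le_of_abs_le (pow_nonneg hr _) fun i j => ?_
  exact abs_sub_mean_le (v := fun i' => windowProd A k (m + 1) i' j)
    (fun a b => windowProd_sub_le hA hL hr hwin k (m + 1) j a b) i
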